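/- Let F_hM > 0, F_rM > 0, Q ∈ ℝ and v ∈ ℝ. Consider the system: −v ∈ N_{[0,F_hM]}(F_h), v ∈ N_{[0,F_rM]}(F_r), 0 ∈ N_{(−∞,P_c]}(P), and f = F_h − F_r. Then the set of values f consistent with this system is gsgn(F_hM, v, −F_rM); in particular, if v > 0 then f = −F_rM, if v < 0 then f = F_hM, and if v = 0 then f can be any value in [−F_rM, F_hM]. -/

import Mathlib

open Set

/-- Normal cone of the closed interval `[A,B]` at `x`. -/
noncomputable def normalCone (A B x : ℝ) : Set ℝ :=
  if x = B then Set.Ici 0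
  else if x = A then Set.Iic 0
  else if A < x ∧ x < B then {0} else (∅ : Set ℝ)

/-- Normal cone of `[0,∞)` at `x`. -/
noncomputable def normalConeIci (x : ℝ) : Set ℝ :=
  if x = 0 then Set.Iic 0
  else if 0 < x then {0} else (∅ : Set ℝ)

/-- Normal cone of `(-∞,M]` at `P`. -/
noncomputable def normalConeIic (M P : ℝ) : Set ℝ :=
  if P = M then Set.Ici 0
  else if P < M then {0} else (∅ : Set ℝ)

/-- Generalized set-valued sign function. -/
noncomputable def gsgn (a y b : ℝ) : Set ℝ :=
  if 0 < y then {b}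
  else if y < 0 then {a}
  else Set.Icc (min a b) (max a b)

/-- Projection onto `[A,B]`. -/
noncomputable def proj (A B x : ℝ) : ℝ := max A (min B x)

/-- Signed square. -/
noncomputable def Ssq (x : ℝ) : ℝ := Real.sign x * x ^ 2

/-- Signed square root. -/
noncomputable def Rsq (x : ℝ) : ℝ := Real.sign x * Real.sqrt |x|

/-- The function `Φ_A` of the paper. -/
noncomputable def PhiA (b c a : ℝ) : ℝ :=
  -Real.sign c * ((Real.sqrt (a ^ 2 * b ^ 2 + 4 * a * |c|) - a * b) / 2)

theorem mem_normalCone_iff_aux {B x w : ℝ} (hB : 0 < B) :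
    w ∈ normalCone 0 B x ↔
      (x = B ∧ 0 ≤ w) ∨ (x = 0 ∧ w ≤ 0) ∨ (0 < x ∧ x < B ∧ w = 0) := by
  unfold normalCone
  split_ifs with h1 h2 h3
  · simp only [Set.mem_Ici]; grind
  · simp only [Set.mem_Iic]; grind
  · simp only [Set.mem_singleton_iff]; grind
  · simp only [Set.mem_empty_iff_false]; grind

theorem zero_mem_normalConeIic_aux : (0 : ℝ) ∈ normalConeIic 0 0 := by
  simp [normalConeIic]

theorem stmt_12 (FhM FrM : ℝ) (hFh : 0 < FhM) (hFr : 0 < FrM) (Q v : ℝ) :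
    {f : ℝ | ∃ Fh Fr Pc P : ℝ,
        -v ∈ normalCone 0 FhM Fh ∧ v ∈ normalCone 0 FrM Fr ∧
        (0 : ℝ) ∈ normalConeIic Pc P ∧ f = Fh - Fr}
      = gsgn FhM v (-FrM) ∧
    (0 < v → ∀ f ∈ gsgn FhM v (-FrM), f = -FrM) ∧
    (v < 0 → ∀ f ∈ gsgn FhM v (-FrM), f = FhM) ∧
    (v = 0 → gsgn FhM v (-FrM) = Set.Icc (-FrM) FhM) := by
  have hz : v = 0 → gsgn FhM v (-FrM) = Set.Icc (-FrM) FhM := by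
    rintro rfl
    have h : -FrM ≤ FhM := by linarith
    simp [gsgn, min_eq_right h, max_eq_left h]
  have hp : 0 < v → gsgn FhM v (-FrM) = {-FrM} := by
    intro h
    simp [gsgn, h]
  have hn : v < 0 → gsgn FhM v (-FrM) = {FhM} := by
    intro h
    simp [gsgn, h, h.le]
  refine ⟨?_, fun h f hf => by simpa [hp h] using hf,
    fun h f hf => by simpa [hn h] using hf, hz⟩
  ext f
  simp only [Set.mem_setOf_eq, mem_normalCone_iff_aux hFh, mem_normalCone_iff_aux hFr]
  rcases lt_trichotomy v 0 with h | h | h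
  · rw [hn h, Set.mem_singleton_iff]
    constructor
    · rintro ⟨Fh, Fr, Pc, P, h1, h2, -, rfl⟩
      grind
    · rintro rfl
      exact ⟨f, 0, 0, 0, Or.inl ⟨rfl, by linarith⟩, Or.inr (Or.inl ⟨rfl, h.le⟩),
        zero_mem_normalConeIic_aux, by ring⟩
  · rw [hz h, Set.mem_Icc]
    constructor
    · rintro ⟨Fh, Fr, Pc, P, h1, h2, -, rfl⟩
      grind
    · rintro ⟨h1, h2⟩
      refine ⟨max f 0, max (-f) 0, 0, 0, ?_, ?_, zero_mem_normalConeIic_aux, ?_⟩ <;> grind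
  · rw [hp h, Set.mem_singleton_iff]
    constructor
    · rintro ⟨Fh, Fr, Pc, P, h1, h2, -, rfl⟩
      grind
    · rintro rfl
      exact ⟨0, FrM, 0, 0, Or.inr (Or.inl ⟨rfl, by linarith⟩), Or.inl ⟨rfl, h.le⟩,
        zero_mem_normalConeIic_aux, by ring⟩
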